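/- Let ε > 0 and suppose η : ℝ^{n-1} → ℝ is in H² with ‖η‖_{H²} < ε, and all second partial derivatives η_{ij} and first partials η_i are in L². Then ‖Div(∇η/√(1+|∇η|²) − ∇η)‖_{L¹} ≤ ‖η‖²_{H²}. -/

import Mathlib

open MeasureTheory

/-- Partial derivative in the i-th coordinate direction on ℝ^m. -/
noncomputable def pd {m : ℕ} (i : Fin m) (f : (Fin m → ℝ) → ℝ) (x : Fin m → ℝ) : ℝ :=
  fderiv ℝ f x (Pi.single i 1)

/-- Square of the H² Sobolev norm, written as an integral. -/
noncomputable def H2normSq {m : ℕ} (η : (Fin m → ℝ) → ℝ) : ℝ :=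
  ∫ x, ((η x) ^ 2 + (∑ i, (pd i η x) ^ 2) + ∑ i, ∑ j, (pd j (pd i η) x) ^ 2)

open Filter Topology

/-- Uniformly `C¹`-bounded compactly supported cutoffs, eventually equal to `1` near each point. -/
theorem exists_contDiff_cutoff_eventuallyEq_one (E : Type*) [NormedAddCommGroup E] [NormedSpace ℝ E]
    [FiniteDimensional ℝ E] : ∃ χ : ℕ → E → ℝ, ∃ C : ℝ,
    (∀ n, ContDiff ℝ 1 (χ n)) ∧ (∀ n, HasCompactSupport (χ n)) ∧ (∀ n x, |χ n x| ≤ 1) ∧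
    (∀ n x, ‖fderiv ℝ (χ n) x‖ ≤ C) ∧ (∀ x, ∀ᶠ n in atTop, χ n =ᶠ[𝓝 x] 1) := by
  let φ : ContDiffBump (0 : E) := ⟨1, 2, one_pos, one_lt_two⟩
  have hφ : ContDiff ℝ 1 φ := φ.contDiff
  obtain ⟨C, hC⟩ := (φ.hasCompactSupport.fderiv ℝ).exists_bound_of_continuous
    (hφ.continuous_fderiv one_ne_zero)
  have hpos (n : ℕ) : (0 : ℝ) < (n + 1 : ℝ)⁻¹ := by positivity
  refine ⟨fun n x => φ ((n + 1 : ℝ)⁻¹ • x), C, fun n => hφ.comp (by fun_prop),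
    fun n => φ.hasCompactSupport.comp_smul (hpos n).ne', fun n x => ?_, fun n x => ?_, fun x => ?_⟩
  · rw [abs_of_nonneg φ.nonneg]
    exact φ.le_one
  · rw [fderiv_comp_smul, norm_smul, Real.norm_of_nonneg (hpos n).le]
    have h1 : (n + 1 : ℝ)⁻¹ ≤ 1 := inv_le_one_of_one_le₀ (by simp)
    calc _ ≤ 1 * ‖fderiv ℝ φ ((n + 1 : ℝ)⁻¹ • x)‖ :=
          mul_le_mul_of_nonneg_right h1 (norm_nonneg _)
      _ ≤ C := by simpa using hC _
  · obtain ⟨N, hN⟩ := exists_nat_gt ‖x‖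
    filter_upwards [eventually_ge_atTop N] with n hn
    have hx : (n + 1 : ℝ)⁻¹ • x ∈ Metric.ball (0 : E) φ.rIn := by
      have : (N : ℝ) ≤ n := by exact_mod_cast hn
      rw [mem_ball_zero_iff, norm_smul, Real.norm_of_nonneg (hpos n).le,
        inv_mul_lt_iff₀ (by positivity)]
      change _ < _ * (1 : ℝ)
      linarith
    exact (by fun_prop : Continuous fun y : E => (n + 1 : ℝ)⁻¹ • y).continuousAt.eventually
      (φ.eventuallyEq_one_of_mem_ball hx)

section IntegrationByParts

variable {E : Type*} [NormedAddCommGroup E] [NormedSpace ℝ E]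
  [MeasurableSpace E] [BorelSpace E] {μ : Measure E} [μ.IsAddHaarMeasure]

theorem hasDerivAt_integral_mul_translate {f g : E → ℝ} (hf : Continuous f)
    (hfc : HasCompactSupport f) (hg : ContDiff ℝ 1 g) (hgc : HasCompactSupport g) (e : E) :
    HasDerivAt (fun h : ℝ => ∫ x, f x * g (x + h • e) ∂μ) (∫ x, f x * fderiv ℝ g x e ∂μ) 0 := by
  have hg' : Continuous fun x => fderiv ℝ g x e :=
    (hg.continuous_fderiv one_ne_zero).clm_apply continuous_const
  have hgcont : Continuous g := hg.continuous
  obtain ⟨C, hC⟩ := (hgc.fderiv_apply ℝ e).exists_bound_of_continuous hg'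
  have key := hasDerivAt_integral_of_dominated_loc_of_deriv_le (μ := μ) (s := Set.univ)
    (F := fun (h : ℝ) x => f x * g (x + h • e)) (x₀ := 0)
    (F' := fun (h : ℝ) x => f x * fderiv ℝ g (x + h • e) e) (bound := fun x => ‖f x‖ * C)
    univ_mem
    (Eventually.of_forall fun h => (by fun_prop : Continuous _).aestronglyMeasurable)
    ((by fun_prop : Continuous _).integrable_of_hasCompactSupport hfc.mul_right)
    ((hf.mul (hg'.comp (by fun_prop : Continuous fun x : E => x + (0 : ℝ) • e))).aestronglyMeasurable)
    (Eventually.of_forall fun x h _ => by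
      rw [norm_mul]
      exact mul_le_mul_of_nonneg_left (hC _) (norm_nonneg _))
    ((hf.norm.integrable_of_hasCompactSupport hfc.norm).mul_const C)
    (Eventually.of_forall fun x h _ => by
      refine HasDerivAt.const_mul _ ?_
      have h1 : HasDerivAt (fun h : ℝ => x + h • e) e h := by
        simpa using ((hasDerivAt_id h).smul_const e).const_add x
      exact ((hg.differentiable one_ne_zero _).hasFDerivAt).comp_hasDerivAt h h1)
  simpa using key.2

variable [FiniteDimensional ℝ E]

theorem integral_fderiv_mul_fderiv_comm_of_hasCompactSupport {u v : E → ℝ}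
    (hu : ContDiff ℝ 1 u) (huc : HasCompactSupport u)
    (hv : ContDiff ℝ 1 v) (hvc : HasCompactSupport v) (a b : E) :
    ∫ x, fderiv ℝ u x a * fderiv ℝ v x b ∂μ = ∫ x, fderiv ℝ u x b * fderiv ℝ v x a ∂μ := by
  have hu' (e : E) : Continuous fun x => fderiv ℝ u x e :=
    (hu.continuous_fderiv one_ne_zero).clm_apply continuous_const
  have hv' (e : E) : Continuous fun x => fderiv ℝ v x e :=
    (hv.continuous_fderiv one_ne_zero).clm_apply continuous_const
  have hF (h : ℝ) : ∫ x, fderiv ℝ u x a * v (x + h • b) ∂μ =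
      - ∫ x, fderiv ℝ v x a * u (x + h • (-b)) ∂μ := by
    have hfd (x : E) : fderiv ℝ (fun y => v (y + h • b)) x = fderiv ℝ v (x + h • b) :=
      fderiv_comp_add_right _
    have hvs : ContDiff ℝ 1 fun y => v (y + h • b) := hv.comp (by fun_prop)
    have := hu.continuous
    have ibp := integral_mul_fderiv_eq_neg_fderiv_mul_of_integrable (μ := μ)
      (f := u) (g := fun y => v (y + h • b)) (v := a)
      (((hu' a).mul hvs.continuous).integrable_of_hasCompactSupport
        (huc.fderiv_apply ℝ a).mul_right)
      ((by
        simp only [hfd]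
        exact hu.continuous.mul ((hv' a).comp (by fun_prop : Continuous fun x : E => x + h • b))
          : Continuous _).integrable_of_hasCompactSupport huc.mul_right)
      ((hu.continuous.mul hvs.continuous).integrable_of_hasCompactSupport huc.mul_right)
      (fun x _ => hu.differentiable one_ne_zero x)
      (fun x _ => hvs.differentiable one_ne_zero x)
    rw [← neg_eq_iff_eq_neg] at ibp
    rw [← ibp, ← integral_add_right_eq_self
      (fun x => fderiv ℝ v x a * u (x + h • (-b))) (h • b)]
    simp [hfd, mul_comm]
  have d1 := hasDerivAt_integral_mul_translate (μ := μ) (hu' a) (huc.fderiv_apply ℝ a) hv hvc b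
  have d2 := (hasDerivAt_integral_mul_translate (μ := μ) (hv' a) (hvc.fderiv_apply ℝ a)
    hu huc (-b)).neg
  have := d1.unique (d2.congr_of_eventuallyEq (Eventually.of_forall hF))
  rw [this, ← integral_neg]
  simp [mul_comm]

/-- For `u, v` in `H¹`, directional derivatives may be exchanged in `∫ ∂ₐu ∂_b v`. -/
theorem integral_fderiv_mul_fderiv_comm {u v : E → ℝ} (hu : ContDiff ℝ 1 u) (hv : ContDiff ℝ 1 v)
    (hu2 : MemLp u 2 μ) (hv2 : MemLp v 2 μ) {a b : E}
    (hua : MemLp (fun x => fderiv ℝ u x a) 2 μ) (hub : MemLp (fun x => fderiv ℝ u x b) 2 μ)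
    (hva : MemLp (fun x => fderiv ℝ v x a) 2 μ) (hvb : MemLp (fun x => fderiv ℝ v x b) 2 μ) :
    ∫ x, fderiv ℝ u x a * fderiv ℝ v x b ∂μ = ∫ x, fderiv ℝ u x b * fderiv ℝ v x a ∂μ := by
  obtain ⟨χ, C, hχ, hχc, hχ1, hχC, hχlim⟩ := exists_contDiff_cutoff_eventuallyEq_one E
  have hcut {w : E → ℝ} (hw : ContDiff ℝ 1 w) (n : ℕ) : ContDiff ℝ 1 fun x => χ n x * w x :=
    (hχ n).mul hw
  have hbound {w : E → ℝ} (hw : ContDiff ℝ 1 w) (e : E) (n : ℕ) (x : E) :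
      ‖fderiv ℝ (fun x => χ n x * w x) x e‖ ≤ ‖fderiv ℝ w x e‖ + C * ‖e‖ * ‖w x‖ := by
    rw [fderiv_fun_mul ((hχ n).differentiable one_ne_zero x) (hw.differentiable one_ne_zero x)]
    simp only [add_apply, smul_apply, smul_eq_mul]
    refine (norm_add_le _ _).trans (add_le_add ?_ ?_)
    · rw [norm_mul]
      exact mul_le_of_le_one_left (norm_nonneg _) (hχ1 n x)
    · rw [norm_mul, mul_comm]
      exact mul_le_mul_of_nonneg_right (((fderiv ℝ (χ n) x).le_opNorm e).trans
        (mul_le_mul_of_nonneg_right (hχC n x) (norm_nonneg e))) (norm_nonneg _)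
  have hlim (w : E → ℝ) (e x : E) :
      Tendsto (fun n => fderiv ℝ (fun x => χ n x * w x) x e) atTop (𝓝 (fderiv ℝ w x e)) := by
    refine tendsto_const_nhds.congr' ?_
    filter_upwards [hχlim x] with n hn
    have : (fun x => χ n x * w x) =ᶠ[𝓝 x] w := by
      filter_upwards [hn] with y hy
      simp [hy]
    rw [this.fderiv_eq]
  have hdom {w : E → ℝ} (hw : MemLp w 2 μ) {e : E} (he : MemLp (fun x => fderiv ℝ w x e) 2 μ) :
      MemLp (fun x => ‖fderiv ℝ w x e‖ + C * ‖e‖ * ‖w x‖) 2 μ :=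
    he.norm.add (hw.norm.const_mul _)
  have hconv (c d : E) (huc : MemLp (fun x => fderiv ℝ u x c) 2 μ)
      (hvd : MemLp (fun x => fderiv ℝ v x d) 2 μ) :
      Tendsto (fun n => ∫ x, fderiv ℝ (fun x => χ n x * u x) x c *
        fderiv ℝ (fun x => χ n x * v x) x d ∂μ) atTop
        (𝓝 (∫ x, fderiv ℝ u x c * fderiv ℝ v x d ∂μ)) := by
    refine tendsto_integral_of_dominated_convergence _ (fun n => ?_)
      ((hdom hu2 huc).integrable_mul (hdom hv2 hvd)) (fun n => Eventually.of_forall fun x => ?_)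
      (Eventually.of_forall fun x => (hlim u c x).mul (hlim v d x))
    · exact (((hcut hu n).continuous_fderiv one_ne_zero).clm_apply continuous_const |>.mul
        (((hcut hv n).continuous_fderiv one_ne_zero).clm_apply
          continuous_const)).aestronglyMeasurable
    · rw [norm_mul]
      exact mul_le_mul (hbound hu c n x) (hbound hv d n x) (norm_nonneg _)
        ((norm_nonneg _).trans (hbound hu c n x))
  refine tendsto_nhds_unique (hconv a b hua hvb) ((hconv b a hub hva).congr fun n => ?_)
  exact integral_fderiv_mul_fderiv_comm_of_hasCompactSupport (hcut hu n) (hχc n).mul_right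
    (hcut hv n) (hχc n).mul_right b a

end IntegrationByParts

theorem abs_one_div_sqrt_one_add_sub_one_le {P : ℝ} (hP : 0 ≤ P) :
    |1 / Real.sqrt (1 + P) - 1| ≤ Real.sqrt P / 2 := by
  set w := Real.sqrt (1 + P) with hw
  set q := Real.sqrt P with hq
  have hw1 : 1 ≤ w := Real.one_le_sqrt.2 (by linarith)
  have hq0 : 0 ≤ q := Real.sqrt_nonneg P
  have hqw : q ≤ w := Real.sqrt_le_sqrt (by linarith)
  have hw2 : w ^ 2 = 1 + q ^ 2 := by rw [hw, hq, Real.sq_sqrt (by linarith), Real.sq_sqrt hP]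
  have : 1 / w ≤ 1 := by rw [div_le_one (by linarith)]; exact hw1
  rw [abs_of_nonpos (by linarith), neg_sub, sub_le_iff_le_add, ← sub_le_iff_le_add',
    le_div_iff₀ (by linarith)]
  nlinarith [mul_nonneg hq0 (sub_nonneg.2 hqw), mul_nonneg hq0 (sub_nonneg.2 hw1)]

theorem div_sqrt_one_add_pow_three_le {P : ℝ} (hP : 0 ≤ P) :
    P / Real.sqrt (1 + P) ^ 3 ≤ Real.sqrt P / 2 := by
  set w := Real.sqrt (1 + P) with hw
  set q := Real.sqrt P with hq
  have hw1 : 1 ≤ w := Real.one_le_sqrt.2 (by linarith)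
  have hq0 : 0 ≤ q := Real.sqrt_nonneg P
  have hPq : P = q ^ 2 := (Real.sq_sqrt hP).symm
  have hw2 : w ^ 2 = 1 + q ^ 2 := by rw [hw, Real.sq_sqrt (by linarith), hPq]
  rw [hPq, div_le_div_iff₀ (by positivity) two_pos]
  have h1 : 2 * q ≤ w ^ 3 := by
    nlinarith [sq_nonneg (q - 1), mul_nonneg (sq_nonneg w) (sub_nonneg.2 hw1)]
  nlinarith [mul_le_mul_of_nonneg_left h1 hq0]

theorem abs_sum_sum_mul_le {ι : Type*} [Fintype ι] (p : ι → ℝ) (H : ι → ι → ℝ) :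
    |∑ i, p i * ∑ j, p j * H j i| ≤
      (∑ i, p i ^ 2) * Real.sqrt (∑ i, ∑ j, H i j ^ 2) := by
  have h (i : ι) : (∑ j, p j * H j i) ^ 2 ≤ (∑ j, p j ^ 2) * ∑ j, H j i ^ 2 :=
    Finset.sum_mul_sq_le_sq_mul_sq _ _ _
  have hP : 0 ≤ ∑ i, p i ^ 2 := Finset.sum_nonneg fun i _ => sq_nonneg _
  have hS : 0 ≤ ∑ i, ∑ j, H i j ^ 2 :=
    Finset.sum_nonneg fun i _ => Finset.sum_nonneg fun j _ => sq_nonneg _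
  refine abs_le_of_sq_le_sq ?_ (by positivity)
  calc _ ≤ (∑ i, p i ^ 2) * ∑ i, (∑ j, p j * H j i) ^ 2 := Finset.sum_mul_sq_le_sq_mul_sq _ _ _
    _ ≤ (∑ i, p i ^ 2) * ∑ i, (∑ j, p j ^ 2) * ∑ j, H j i ^ 2 :=
        mul_le_mul_of_nonneg_left (Finset.sum_le_sum fun i _ => h i) hP
    _ = _ := by
        rw [← Finset.mul_sum, Finset.sum_comm, mul_pow, Real.sq_sqrt hS]
        ring

theorem abs_mean_curvature_sub_trace_le {ι : Type*} [Fintype ι] (p : ι → ℝ) (H : ι → ι → ℝ) :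
    |(∑ i, H i i) * (1 / Real.sqrt (1 + ∑ j, p j ^ 2) - 1) -
        (∑ i, p i * ∑ j, p j * H j i) / Real.sqrt (1 + ∑ j, p j ^ 2) ^ 3| ≤
      1 / 2 * ∑ i, p i ^ 2 + 1 / 4 * (∑ i, H i i) ^ 2 + 1 / 4 * ∑ i, ∑ j, H i j ^ 2 := by
  have hP : 0 ≤ ∑ i, p i ^ 2 := Finset.sum_nonneg fun i _ => sq_nonneg _
  have hS : 0 ≤ ∑ i, ∑ j, H i j ^ 2 :=
    Finset.sum_nonneg fun i _ => Finset.sum_nonneg fun j _ => sq_nonneg _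
  have hA := abs_one_div_sqrt_one_add_sub_one_le hP
  have hB := div_sqrt_one_add_pow_three_le hP
  have hD := abs_sum_sum_mul_le p H
  set P := ∑ i, p i ^ 2
  set S := ∑ i, ∑ j, H i j ^ 2
  set T := ∑ i, H i i
  have hw : 0 < Real.sqrt (1 + P) := Real.sqrt_pos.2 (by linarith)
  have hq := Real.sq_sqrt hP
  have hs := Real.sq_sqrt hS
  set q := Real.sqrt P
  set s := Real.sqrt S
  have hs0 : 0 ≤ s := Real.sqrt_nonneg S
  have h1 : |T * (1 / Real.sqrt (1 + P) - 1)| ≤ |T| * (q / 2) := by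
    rw [abs_mul]
    exact mul_le_mul_of_nonneg_left hA (abs_nonneg T)
  have h2 : |(∑ i, p i * ∑ j, p j * H j i) / Real.sqrt (1 + P) ^ 3| ≤ q / 2 * s := by
    rw [abs_div, abs_of_pos (pow_pos hw 3)]
    calc _ ≤ P * s / Real.sqrt (1 + P) ^ 3 := by gcongr
      _ = P / Real.sqrt (1 + P) ^ 3 * s := by ring
      _ ≤ _ := mul_le_mul_of_nonneg_right hB hs0
  refine (abs_sub _ _).trans ?_
  nlinarith [sq_nonneg (|T| - q), sq_nonneg (q - s), sq_abs T]

theorem pd_div_sqrt_sub {m : ℕ} {p : Fin m → (Fin m → ℝ) → ℝ} {x : Fin m → ℝ}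
    (hp : ∀ i, DifferentiableAt ℝ (p i) x) (i : Fin m) :
    pd i (fun y => p i y / Real.sqrt (1 + ∑ j, p j y ^ 2) - p i y) x =
      pd i (p i) x * (1 / Real.sqrt (1 + ∑ j, p j x ^ 2) - 1) -
        p i x * (∑ j, p j x * pd i (p j) x) / Real.sqrt (1 + ∑ j, p j x ^ 2) ^ 3 := by
  have hpos : 0 < 1 + ∑ j, p j x ^ 2 := by positivity
  have hw : 0 < Real.sqrt (1 + ∑ j, p j x ^ 2) := Real.sqrt_pos.2 hpos
  have hsum : HasFDerivAt (fun y => 1 + ∑ j, p j y ^ 2)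
      (∑ j, (2 * p j x) • fderiv ℝ (p j) x) x := by
    refine HasFDerivAt.const_add _ (HasFDerivAt.fun_sum fun j _ => ?_)
    simpa using (hp j).hasFDerivAt.pow 2
  have hd := ((hp i).hasFDerivAt.mul ((hasDerivAt_inv hw.ne').comp_hasFDerivAt x
    (hsum.sqrt hpos.ne'))).sub (hp i).hasFDerivAt
  have hd' : HasFDerivAt (fun y => p i y / Real.sqrt (1 + ∑ j, p j y ^ 2) - p i y) _ x := hd
  simp only [pd]
  rw [hd'.fderiv]
  simp only [sub_apply, add_apply, smul_apply, smul_eq_mul, sum_apply, Function.comp_apply]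
  have h2 : ∑ j, 2 * p j x * (fderiv ℝ (p j) x) (Pi.single i 1) =
      2 * ∑ j, p j x * (fderiv ℝ (p j) x) (Pi.single i 1) := by
    rw [Finset.mul_sum]
    exact Finset.sum_congr rfl fun j _ => by ring
  rw [h2]
  field_simp
  ring

theorem contDiff_pd {m : ℕ} {η : (Fin m → ℝ) → ℝ} (hη : ContDiff ℝ 2 η) (i : Fin m) :
    ContDiff ℝ 1 (pd i η) :=
  (hη.fderiv_right (by norm_num)).clm_apply contDiff_const

theorem continuous_pd {m : ℕ} {f : (Fin m → ℝ) → ℝ} (hf : ContDiff ℝ 1 f) (i : Fin m) :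
    Continuous (pd i f) :=
  (hf.continuous_fderiv one_ne_zero).clm_apply continuous_const

/-- The `L²` norm of the Laplacian is at most that of the Hessian. -/
theorem integral_sq_laplacian_le {m : ℕ} {η : (Fin m → ℝ) → ℝ} (hsmooth : ContDiff ℝ 2 η)
    (h1 : ∀ i : Fin m, Integrable (fun x => (pd i η x) ^ 2))
    (h2 : ∀ i j : Fin m, Integrable (fun x => (pd j (pd i η) x) ^ 2)) :
    Integrable (fun x => (∑ i, pd i (pd i η) x) ^ 2) ∧
    ∫ x, (∑ i, pd i (pd i η) x) ^ 2 ≤ ∫ x, ∑ i, ∑ j, (pd j (pd i η) x) ^ 2 := by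
  have hm1 (i : Fin m) : MemLp (pd i η) 2 :=
    (memLp_two_iff_integrable_sq (contDiff_pd hsmooth i).continuous.aestronglyMeasurable).2 (h1 i)
  have hm2 (i j : Fin m) : MemLp (pd j (pd i η)) 2 :=
    (memLp_two_iff_integrable_sq
      (continuous_pd (contDiff_pd hsmooth i) j).aestronglyMeasurable).2 (h2 i j)
  have hint (i j k l : Fin m) :
      Integrable (fun x => pd j (pd i η) x * pd l (pd k η) x) :=
    (hm2 i j).integrable_mul (hm2 k l)
  have hcomm (i j : Fin m) : ∫ x, pd i (pd i η) x * pd j (pd j η) x =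
      ∫ x, pd j (pd i η) x * pd i (pd j η) x :=
    integral_fderiv_mul_fderiv_comm (contDiff_pd hsmooth i) (contDiff_pd hsmooth j)
      (hm1 i) (hm1 j) (hm2 i i) (hm2 i j) (hm2 j i) (hm2 j j)
  have hle (i j : Fin m) : ∫ x, pd j (pd i η) x * pd i (pd j η) x ≤
      1 / 2 * (∫ x, (pd j (pd i η) x) ^ 2) + 1 / 2 * ∫ x, (pd i (pd j η) x) ^ 2 := by
    rw [← integral_const_mul, ← integral_const_mul,
      ← integral_add ((h2 i j).const_mul _) ((h2 j i).const_mul _)]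
    refine integral_mono (hint i j j i) (((h2 i j).const_mul _).add ((h2 j i).const_mul _))
      fun x => ?_
    simp only
    nlinarith [sq_nonneg (pd j (pd i η) x - pd i (pd j η) x)]
  have hexp (x : Fin m → ℝ) : (∑ i, pd i (pd i η) x) ^ 2 =
      ∑ i, ∑ j, pd i (pd i η) x * pd j (pd j η) x := by
    rw [sq, Finset.sum_mul_sum]
  simp only [hexp]
  refine ⟨integrable_finsetSum _ fun i _ => integrable_finsetSum _ fun j _ => hint i i j j, ?_⟩
  rw [integral_finsetSum _ fun i _ => integrable_finsetSum _ fun j _ => hint i i j j,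
    integral_finsetSum _ fun i _ => integrable_finsetSum _ fun j _ => h2 i j]
  simp_rw [integral_finsetSum _ fun j _ => hint _ _ j j, integral_finsetSum _ fun j _ => h2 _ j]
  calc _ ≤ ∑ i, ∑ j, (1 / 2 * (∫ x, (pd j (pd i η) x) ^ 2) +
        1 / 2 * ∫ x, (pd i (pd j η) x) ^ 2) :=
        Finset.sum_le_sum fun i _ => Finset.sum_le_sum fun j _ => (hcomm i j).trans_le (hle i j)
    _ = _ := by
        simp only [Finset.sum_add_distrib, ← Finset.mul_sum]
        rw [Finset.sum_comm (f := fun i j => ∫ x, (pd i (pd j η) x) ^ 2)]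
        ring

theorem stmt13 {m : ℕ} (ε : ℝ) (hε : 0 < ε) (η : (Fin m → ℝ) → ℝ)
    (hsmooth : ContDiff ℝ 2 η)
    (hη : Integrable (fun x => (η x) ^ 2))
    (h1 : ∀ i : Fin m, Integrable (fun x => (pd i η x) ^ 2))
    (h2 : ∀ i j : Fin m, Integrable (fun x => (pd j (pd i η) x) ^ 2))
    (hH2 : H2normSq η < ε ^ 2) :
    ∫ x, |∑ i, pd i (fun y =>
        pd i η y / Real.sqrt (1 + ∑ j, (pd j η y) ^ 2) - pd i η y) x|
      ≤ H2normSq η := by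
  obtain ⟨hLint, hL⟩ := integral_sq_laplacian_le hsmooth h1 h2
  have hPint : Integrable fun x => ∑ i, (pd i η x) ^ 2 := integrable_finsetSum _ fun i _ => h1 i
  have hSint : Integrable fun x => ∑ i, ∑ j, (pd j (pd i η) x) ^ 2 :=
    integrable_finsetSum _ fun i _ => integrable_finsetSum _ fun j _ => h2 i j
  have hpt (x : Fin m → ℝ) : |∑ i, pd i (fun y =>
        pd i η y / Real.sqrt (1 + ∑ j, (pd j η y) ^ 2) - pd i η y) x| ≤
      1 / 2 * ∑ i, (pd i η x) ^ 2 + 1 / 4 * (∑ i, pd i (pd i η) x) ^ 2 +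
        1 / 4 * ∑ i, ∑ j, (pd j (pd i η) x) ^ 2 := by
    refine le_trans (le_of_eq ?_)
      (abs_mean_curvature_sub_trace_le (fun i => pd i η x) fun i j => pd j (pd i η) x)
    rw [Finset.sum_mul, Finset.sum_div, ← Finset.sum_sub_distrib]
    exact congrArg _ (Finset.sum_congr rfl fun i _ =>
      pd_div_sqrt_sub (fun j => (contDiff_pd hsmooth j).differentiable one_ne_zero x) i)
  have hη0 : 0 ≤ ∫ x, (η x) ^ 2 := integral_nonneg fun x => sq_nonneg _
  have hP0 : 0 ≤ ∫ x, ∑ i, (pd i η x) ^ 2 :=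
    integral_nonneg fun x => Finset.sum_nonneg fun i _ => sq_nonneg _
  have hS0 : 0 ≤ ∫ x, ∑ i, ∑ j, (pd j (pd i η) x) ^ 2 :=
    integral_nonneg fun x => Finset.sum_nonneg fun i _ => Finset.sum_nonneg fun j _ => sq_nonneg _
  have hH : H2normSq η = (∫ x, (η x) ^ 2) + (∫ x, ∑ i, (pd i η x) ^ 2) +
      ∫ x, ∑ i, ∑ j, (pd j (pd i η) x) ^ 2 :=
    (integral_add' (hη.add hPint) hSint).trans (congrArg (· + _) (integral_add' hη hPint))
  refine (integral_mono_of_nonneg (Eventually.of_forall fun x => abs_nonneg _)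
    (((hPint.const_mul (1 / 2)).add (hLint.const_mul (1 / 4))).add (hSint.const_mul (1 / 4)))
    (Eventually.of_forall hpt)).trans ?_
  rw [integral_add' ((hPint.const_mul _).add (hLint.const_mul _)) (hSint.const_mul _),
    integral_add' (hPint.const_mul _) (hLint.const_mul _), integral_const_mul, integral_const_mul,
    integral_const_mul, hH]
  linarith
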